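/- arXiv:1405.4031 — 2 statements merged into one kernel-verified Lean document; each statement's English description precedes it below -/
import Mathlib

section
/- For every q ∈ [0,1] and every integer n ≥ 1, one has √(k(qⁿ)) ≥ 2^(1−n) · (√(k(q)))ⁿ, equivalently k(q)ⁿ ≤ 4^(n−1) · k(qⁿ). -/
noncomputable section

/-- The Jacobi theta value `θ₂(q) = ∑_{j ∈ ℤ} q^((j+1/2)²)`. -/
def jacobiThetaTwo (q : ℝ) : ℝ := ∑' j : ℤ, q ^ (((j : ℝ) + 1 / 2) ^ 2)

/-- The Jacobi theta value `θ₃(q) = ∑_{j ∈ ℤ} q^(j²)`. -/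
def jacobiThetaThree (q : ℝ) : ℝ := ∑' j : ℤ, q ^ ((j : ℝ) ^ 2)

/-- The elliptic modulus `k(q) = (θ₂(q)/θ₃(q))²` for `q ∈ (0,1)`, extended
continuously by `k(0) = 0` and `k(1) = 1`. -/
def ellipticModulus (q : ℝ) : ℝ :=
  if q ≤ 0 then 0 else if 1 ≤ q then 1
  else (jacobiThetaTwo q / jacobiThetaThree q) ^ 2

/-- Exponents `(j + s)²` with `0 ≤ s ≤ 1/2` give a summable family of powers. -/
theorem summable_rpow_add_sq {q : ℝ} (hq0 : 0 < q) (hq1 : q < 1) {s : ℝ} (hs0 : 0 ≤ s)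
    (hs1 : s ≤ 1 / 2) : Summable fun j : ℤ => q ^ (((j : ℝ) + s) ^ 2) := by
  have hgeom : Summable fun j : ℤ => q ^ (|(j : ℝ)| - 1) := by
    have hnat : Summable fun n : ℕ => q ^ ((n : ℝ) - 1) := by
      refine ((summable_geometric_of_lt_one hq0.le hq1).mul_right q⁻¹).congr fun n => ?_
      rw [Real.rpow_sub_one hq0.ne', Real.rpow_natCast, div_eq_mul_inv]
    exact Summable.of_nat_of_neg (by simpa using hnat) (by simpa using hnat)
  refine hgeom.of_nonneg_of_le (fun j => (Real.rpow_pos_of_pos hq0 _).le) fun j => ?_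
  refine Real.rpow_le_rpow_of_exponent_ge hq0 hq1.le ?_
  rcases abs_cases (j : ℝ) with ⟨h, hj⟩ | ⟨h, hj⟩ <;> rw [h] <;>
    nlinarith [sq_nonneg ((j : ℝ) - 1), sq_nonneg ((j : ℝ) + 1), mul_nonneg hs0 hs0]

theorem summable_jacobiThetaTwo {q : ℝ} (hq0 : 0 < q) (hq1 : q < 1) :
    Summable fun j : ℤ => q ^ (((j : ℝ) + 1 / 2) ^ 2) :=
  summable_rpow_add_sq hq0 hq1 (by norm_num) le_rfl

theorem summable_jacobiThetaThree {q : ℝ} (hq0 : 0 < q) (hq1 : q < 1) :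
    Summable fun j : ℤ => q ^ ((j : ℝ) ^ 2) := by
  simpa using summable_rpow_add_sq hq0 hq1 le_rfl (by norm_num)

/-- Pairs of integers split according to the parity of their sum. -/
def intSumEquivEvenOdd : (ℤ × ℤ) ⊕ (ℤ × ℤ) ≃ ℤ × ℤ :=
  Equiv.ofBijective
    (Sum.elim (fun p => (p.1 + p.2, p.1 - p.2)) fun p => (p.1 + p.2 + 1, p.1 - p.2)) <| by
    constructor
    · rintro (⟨a, b⟩ | ⟨a, b⟩) (⟨c, d⟩ | ⟨c, d⟩) h <;>
        simp only [Sum.elim_inl, Sum.elim_inr, Prod.mk.injEq, Sum.inl.injEq, Sum.inr.injEq,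
          reduceCtorEq] at h ⊢ <;> omega
    · rintro ⟨a, b⟩
      rcases Int.even_or_odd' (a + b) with ⟨c, h | h⟩
      · exact ⟨Sum.inl (c, a - c), by simp only [Sum.elim_inl, Prod.mk.injEq]; omega⟩
      · exact ⟨Sum.inr (c, a - c - 1), by simp only [Sum.elim_inr, Prod.mk.injEq]; omega⟩

theorem tsum_int_prod_eq_even_add_odd {F : ℤ × ℤ → ℝ} (hF : Summable F) :
    ∑' p, F p = ∑' p : ℤ × ℤ, F (p.1 + p.2, p.1 - p.2) +
      ∑' p : ℤ × ℤ, F (p.1 + p.2 + 1, p.1 - p.2) := by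
  have h := (intSumEquivEvenOdd.summable_iff (f := F)).2 hF
  rw [← intSumEquivEvenOdd.tsum_eq F]
  exact Summable.tsum_sum (h.comp_injective Sum.inl_injective)
    (h.comp_injective Sum.inr_injective)

theorem tsum_int_mul_tsum_int {f g : ℤ → ℝ} (hf : Summable f) (hg : Summable g)
    (hf0 : 0 ≤ f) (hg0 : 0 ≤ g) :
    (Summable fun p : ℤ × ℤ => f p.1 * g p.2) ∧
      (∑' j, f j) * ∑' j, g j = ∑' p : ℤ × ℤ, f p.1 * g p.2 := by
  have h := hf.mul_of_nonneg hg hf0 hg0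
  exact ⟨h, hf.tsum_mul_tsum hg h⟩

theorem jacobiThetaThree_sq {q : ℝ} (hq0 : 0 < q) (hq1 : q < 1) :
    jacobiThetaThree q ^ 2 = jacobiThetaThree (q ^ 2) ^ 2 + jacobiThetaTwo (q ^ 2) ^ 2 := by
  have hp0 : 0 < q ^ 2 := by positivity
  have hp1 : q ^ 2 < 1 := pow_lt_one₀ hq0.le hq1 two_ne_zero
  have h3 := summable_jacobiThetaThree hq0 hq1
  have h3' := summable_jacobiThetaThree hp0 hp1
  have h2' := summable_jacobiThetaTwo hp0 hp1
  obtain ⟨hs, he⟩ := tsum_int_mul_tsum_int h3 h3 (fun _ => by positivity) fun _ => by positivity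
  have he3 := (tsum_int_mul_tsum_int h3' h3' (fun _ => by positivity) fun _ => by positivity).2
  have he2 := (tsum_int_mul_tsum_int h2' h2' (fun _ => by positivity) fun _ => by positivity).2
  simp only [sq (jacobiThetaThree _), sq (jacobiThetaTwo _)]
  unfold jacobiThetaThree jacobiThetaTwo
  rw [he, he3, he2, tsum_int_prod_eq_even_add_odd hs]
  congr 1 <;> refine tsum_congr fun p => ?_ <;>
    rw [← Real.rpow_natCast q 2, ← Real.rpow_add hq0, ← Real.rpow_mul hq0.le,
      ← Real.rpow_mul hq0.le, ← Real.rpow_add hq0] <;> congr 1 <;> push_cast <;> ring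

theorem jacobiThetaTwo_sq {q : ℝ} (hq0 : 0 < q) (hq1 : q < 1) :
    jacobiThetaTwo q ^ 2 = 2 * (jacobiThetaTwo (q ^ 2) * jacobiThetaThree (q ^ 2)) := by
  have hp0 : 0 < q ^ 2 := by positivity
  have hp1 : q ^ 2 < 1 := pow_lt_one₀ hq0.le hq1 two_ne_zero
  have h2 := summable_jacobiThetaTwo hq0 hq1
  have h3' := summable_jacobiThetaThree hp0 hp1
  have h2' := summable_jacobiThetaTwo hp0 hp1
  obtain ⟨hs, he⟩ := tsum_int_mul_tsum_int h2 h2 (fun _ => by positivity) fun _ => by positivity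
  have he23 := (tsum_int_mul_tsum_int h2' h3' (fun _ => by positivity) fun _ => by positivity).2
  have he32 := (tsum_int_mul_tsum_int h3' h2' (fun _ => by positivity) fun _ => by positivity).2
  rw [two_mul]
  nth_rewrite 2 [mul_comm]
  rw [sq]
  unfold jacobiThetaThree jacobiThetaTwo
  rw [he, he23, he32, tsum_int_prod_eq_even_add_odd hs]
  congr 1
  · refine tsum_congr fun p => ?_
    rw [← Real.rpow_natCast q 2, ← Real.rpow_add hq0, ← Real.rpow_mul hq0.le,
      ← Real.rpow_mul hq0.le, ← Real.rpow_add hq0]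
    congr 1
    push_cast
    ring
  · let e : ℤ × ℤ ≃ ℤ × ℤ := (Equiv.addRight 1).prodCongr (Equiv.refl ℤ)
    rw [← e.tsum_eq fun p : ℤ × ℤ => (q ^ 2) ^ ((p.1 : ℝ) ^ 2) *
      (q ^ 2) ^ (((p.2 : ℝ) + 1 / 2) ^ 2)]
    refine tsum_congr fun p => ?_
    rw [← Real.rpow_natCast q 2, ← Real.rpow_add hq0, ← Real.rpow_mul hq0.le,
      ← Real.rpow_mul hq0.le, ← Real.rpow_add hq0]
    congr 1
    simp only [e, Equiv.prodCongr_apply, Prod.map, Equiv.coe_addRight, Equiv.refl_apply]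
    push_cast
    ring

theorem one_le_jacobiThetaThree {q : ℝ} (hq0 : 0 < q) (hq1 : q < 1) :
    1 ≤ jacobiThetaThree q := by
  have h := (summable_jacobiThetaThree hq0 hq1).le_tsum 0 fun j _ => by positivity
  simpa [jacobiThetaThree] using h

theorem jacobiThetaThree_le {x q : ℝ} (hx0 : 0 < x) (hxq : x ≤ q) (hq1 : q < 1) :
    jacobiThetaThree x ≤ jacobiThetaThree q :=
  (summable_jacobiThetaThree hx0 (hxq.trans_lt hq1)).tsum_le_tsum
    (fun _ => Real.rpow_le_rpow hx0.le hxq (sq_nonneg _))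
    (summable_jacobiThetaThree (hx0.trans_le hxq) hq1)

theorem two_mul_rpow_le_jacobiThetaTwo {q : ℝ} (hq0 : 0 < q) (hq1 : q < 1) :
    2 * q ^ (1 / 4 : ℝ) ≤ jacobiThetaTwo q := by
  have h := (summable_jacobiThetaTwo hq0 hq1).sum_le_tsum {0, -1} fun j _ => by positivity
  rw [Finset.sum_pair (by norm_num)] at h
  norm_num at h
  unfold jacobiThetaTwo
  norm_num
  linarith

theorem jacobiThetaTwo_le {x q : ℝ} (hx0 : 0 < x) (hxq : x ≤ q) (hq1 : q < 1) :
    jacobiThetaTwo x ≤ x ^ (1 / 4 : ℝ) * (jacobiThetaTwo q / q ^ (1 / 4 : ℝ)) := by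
  have hq0 := hx0.trans_le hxq
  unfold jacobiThetaTwo
  rw [← tsum_div_const, ← tsum_mul_left]
  refine (summable_jacobiThetaTwo hx0 (hxq.trans_lt hq1)).tsum_le_tsum (fun j => ?_)
    (((summable_jacobiThetaTwo hq0 hq1).div_const _).mul_left _)
  have hj : (0 : ℝ) ≤ ((j : ℝ) + 1 / 2) ^ 2 - 1 / 4 := by
    have : 0 ≤ j * (j + 1) := by
      rcases le_or_gt 0 j with h | h <;> nlinarith
    have : (0 : ℝ) ≤ j * (j + 1) := by exact_mod_cast this
    linarith
  rw [← Real.rpow_sub hq0]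
  calc x ^ (((j : ℝ) + 1 / 2) ^ 2)
      = x ^ (1 / 4 : ℝ) * x ^ (((j : ℝ) + 1 / 2) ^ 2 - 1 / 4) := by
        rw [← Real.rpow_add hx0]; congr 1; ring
    _ ≤ _ := by gcongr

/-- The square root `θ₂(q) / θ₃(q)` of the elliptic modulus. -/
def thetaRatio (q : ℝ) : ℝ := jacobiThetaTwo q / jacobiThetaThree q

theorem thetaRatio_pos {q : ℝ} (hq0 : 0 < q) (hq1 : q < 1) : 0 < thetaRatio q :=
  div_pos ((by positivity : 0 < 2 * q ^ (1 / 4 : ℝ)).trans_le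
    (two_mul_rpow_le_jacobiThetaTwo hq0 hq1))
    (zero_lt_one.trans_le (one_le_jacobiThetaThree hq0 hq1))

/-- The descending Landen transformation. -/
theorem thetaRatio_sq {q : ℝ} (hq0 : 0 < q) (hq1 : q < 1) :
    thetaRatio q ^ 2 = 2 * thetaRatio (q ^ 2) / (1 + thetaRatio (q ^ 2) ^ 2) := by
  have h := one_le_jacobiThetaThree (q := q ^ 2) (by positivity)
    (pow_lt_one₀ hq0.le hq1 two_ne_zero)
  have h3 : jacobiThetaThree (q ^ 2) ≠ 0 := by positivity
  have : jacobiThetaThree (q ^ 2) ^ 2 + jacobiThetaTwo (q ^ 2) ^ 2 ≠ 0 := by positivity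
  unfold thetaRatio
  rw [div_pow, jacobiThetaThree_sq hq0 hq1, jacobiThetaTwo_sq hq0 hq1]
  field_simp

theorem thetaRatio_le_one {q : ℝ} (hq0 : 0 < q) (hq1 : q < 1) : thetaRatio q ≤ 1 := by
  rw [← sq_le_one_iff₀ (thetaRatio_pos hq0 hq1).le, thetaRatio_sq hq0 hq1,
    div_le_one (by positivity)]
  linarith [sq_nonneg (thetaRatio (q ^ 2) - 1)]

theorem thetaRatio_le_of_sq {a b : ℝ} (ha0 : 0 < a) (ha1 : a < 1) (hb0 : 0 < b) (hb1 : b < 1)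
    (h : thetaRatio (a ^ 2) ≤ thetaRatio (b ^ 2)) : thetaRatio a ≤ thetaRatio b := by
  have hb2 : b ^ 2 < 1 := pow_lt_one₀ hb0.le hb1 two_ne_zero
  have hA := thetaRatio_pos (q := a ^ 2) (by positivity) (pow_lt_one₀ ha0.le ha1 two_ne_zero)
  have hB1 := thetaRatio_le_one (q := b ^ 2) (by positivity) hb2
  rw [← sq_le_sq₀ (thetaRatio_pos ha0 ha1).le (thetaRatio_pos hb0 hb1).le,
    thetaRatio_sq ha0 ha1, thetaRatio_sq hb0 hb1, div_le_div_iff₀ (by positivity) (by positivity)]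
  have hAB : thetaRatio (a ^ 2) * thetaRatio (b ^ 2) ≤ 1 :=
    mul_le_one₀ (h.trans hB1) (hA.le.trans h) hB1
  nlinarith [mul_nonneg (sub_nonneg.2 h) (sub_nonneg.2 hAB)]

/-- On `(0, q]` the ratio `θ₂ / θ₃` is comparable to the fourth root. -/
theorem exists_thetaRatio_bounds {q : ℝ} (hq0 : 0 < q) (hq1 : q < 1) :
    ∃ c C : ℝ, 0 < c ∧ 0 < C ∧ ∀ x, 0 < x → x ≤ q →
      c * x ^ (1 / 4 : ℝ) ≤ thetaRatio x ∧ thetaRatio x ≤ C * x ^ (1 / 4 : ℝ) := by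
  have hE := one_le_jacobiThetaThree hq0 hq1
  have hD := two_mul_rpow_le_jacobiThetaTwo hq0 hq1
  have hD0 : 0 < jacobiThetaTwo q := lt_of_lt_of_le (by positivity) hD
  refine ⟨2 / jacobiThetaThree q, jacobiThetaTwo q / q ^ (1 / 4 : ℝ), by positivity,
    by positivity, fun x hx0 hxq => ⟨?_, ?_⟩⟩
  · have h3 := one_le_jacobiThetaThree hx0 (hxq.trans_lt hq1)
    have h2 := two_mul_rpow_le_jacobiThetaTwo hx0 (hxq.trans_lt hq1)
    rw [div_mul_eq_mul_div]
    exact div_le_div₀ (le_trans (by positivity) h2) h2 (by positivity)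
      (jacobiThetaThree_le hx0 hxq hq1)
  · have h3 := one_le_jacobiThetaThree hx0 (hxq.trans_lt hq1)
    have h2 := two_mul_rpow_le_jacobiThetaTwo hx0 (hxq.trans_lt hq1)
    rw [mul_comm]
    exact (div_le_self (le_trans (by positivity) h2) h3).trans (jacobiThetaTwo_le hx0 hxq hq1)

/-- If the powers `t ^ (2 ^ k)` are bounded above, then `t ≤ 1`. -/
theorem le_one_of_forall_pow_two_pow_le {t M : ℝ} (h : ∀ k : ℕ, t ^ 2 ^ k ≤ M) : t ≤ 1 := by
  by_contra! ht
  obtain ⟨k, hk⟩ := pow_unbounded_of_one_lt M ht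
  exact absurd ((pow_le_pow_right₀ ht.le Nat.lt_two_pow_self.le).trans (h k)) hk.not_ge

theorem thetaRatio_mono {a b : ℝ} (ha0 : 0 < a) (hab : a ≤ b) (hb1 : b < 1) :
    thetaRatio a ≤ thetaRatio b := by
  have hb0 := ha0.trans_le hab
  have ha1 := hab.trans_lt hb1
  by_contra! hlt
  have hpow : ∀ k : ℕ, thetaRatio (b ^ 2 ^ k) < thetaRatio (a ^ 2 ^ k) := by
    intro k
    induction k with
    | zero => simpa using hlt
    | succ k ih =>
      by_contra! hk
      rw [pow_succ, pow_mul, pow_mul] at hk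
      exact ih.not_ge (thetaRatio_le_of_sq (by positivity)
        (pow_lt_one₀ ha0.le ha1 (by positivity)) (by positivity)
        (pow_lt_one₀ hb0.le hb1 (by positivity)) hk)
  obtain ⟨c, C, hc, hC, hbd⟩ := exists_thetaRatio_bounds hb0 hb1
  have hratio : b ^ (1 / 4 : ℝ) / a ^ (1 / 4 : ℝ) ≤ 1 := by
    refine le_one_of_forall_pow_two_pow_le (M := C / c) fun k => ?_
    have hbk : b ^ 2 ^ k ≤ b := pow_le_of_le_one hb0.le hb1.le (by positivity)
    have hak : a ^ 2 ^ k ≤ b := (pow_le_of_le_one ha0.le ha1.le (by positivity)).trans hab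
    have h := ((hbd _ (by positivity) hbk).1.trans (hpow k).le).trans
      (hbd _ (by positivity) hak).2
    rw [← Real.rpow_pow_comm hb0.le, ← Real.rpow_pow_comm ha0.le] at h
    rw [div_pow, div_le_div_iff₀ (by positivity) hc]
    linarith
  rw [div_le_one (by positivity), Real.rpow_le_rpow_iff hb0.le ha0.le (by norm_num)] at hratio
  rw [le_antisymm hab hratio] at hlt
  exact lt_irrefl _ hlt

theorem thetaRatio_pow_le {n : ℕ} (hn : 1 ≤ n) {q : ℝ} (hq0 : 0 < q) (hq1 : q < 1) :
    thetaRatio q ^ n ≤ 2 ^ (n - 1) * thetaRatio (q ^ n) := by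
  obtain ⟨m, rfl⟩ : ∃ m, n = m + 1 := ⟨n - 1, by omega⟩
  rw [Nat.add_sub_cancel]
  set r : ℝ → ℝ := fun x => thetaRatio x ^ (m + 1) / (2 ^ m * thetaRatio (x ^ (m + 1))) with hr
  have hpos : ∀ x, 0 < x → x < 1 → 0 < thetaRatio (x ^ (m + 1)) := fun x hx0 hx1 =>
    thetaRatio_pos (by positivity) (pow_lt_one₀ hx0.le hx1 (by positivity))
  have hstep : ∀ x, 0 < x → x < 1 → r x ^ 2 ≤ r (x ^ 2) := by
    intro x hx0 hx1
    have hy1 : x ^ 2 < 1 := pow_lt_one₀ hx0.le hx1 two_ne_zero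
    have hu := thetaRatio_pos (by positivity) hy1
    have hv := hpos (x ^ 2) (by positivity) hy1
    have hvu : thetaRatio ((x ^ 2) ^ (m + 1)) ≤ thetaRatio (x ^ 2) :=
      thetaRatio_mono (by positivity) (pow_le_of_le_one (by positivity) hy1.le (by positivity)) hy1
    have hL := thetaRatio_sq hx0 hx1
    have hR := thetaRatio_sq (q := x ^ (m + 1)) (by positivity)
      (pow_lt_one₀ hx0.le hx1 (by positivity))
    rw [pow_right_comm] at hR
    have hR0 := hpos x hx0 hx1
    simp only [hr]
    generalize thetaRatio (x ^ 2) = u at *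
    generalize thetaRatio ((x ^ 2) ^ (m + 1)) = v at *
    rw [div_pow, mul_pow, pow_right_comm, hL, hR, div_pow,
      div_le_div_iff₀ (by positivity) (by positivity)]
    have key : 1 + v ^ 2 ≤ (1 + u ^ 2) ^ (m + 1) :=
      (by gcongr : 1 + v ^ 2 ≤ 1 + u ^ 2).trans
        (le_self_pow₀ (by nlinarith [sq_nonneg u]) (by positivity))
    rw [mul_pow, div_mul_eq_mul_div, mul_div_assoc', mul_div_assoc',
      div_le_div_iff₀ (by positivity) (by positivity)]
    calc 2 ^ (m + 1) * u ^ (m + 1) * (2 ^ m * v) * (1 + v ^ 2)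
        ≤ 2 ^ (m + 1) * u ^ (m + 1) * (2 ^ m * v) * (1 + u ^ 2) ^ (m + 1) := by gcongr
      _ = _ := by ring
  have hiter : ∀ k : ℕ, r q ^ 2 ^ k ≤ r (q ^ 2 ^ k) := by
    intro k
    induction k with
    | zero => simp
    | succ k ih =>
      have h0 : 0 ≤ r q := by
        have := hpos q hq0 hq1
        have := thetaRatio_pos hq0 hq1
        positivity
      rw [pow_succ, pow_mul, pow_mul]
      exact (pow_le_pow_left₀ (by positivity) ih 2).trans
        (hstep _ (by positivity) (pow_lt_one₀ hq0.le hq1 (by positivity)))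
  obtain ⟨c, C, hc, hC, hbd⟩ := exists_thetaRatio_bounds hq0 hq1
  have hbound : ∀ x, 0 < x → x ≤ q → r x ≤ C ^ (m + 1) / (2 ^ m * c) := by
    intro x hx0 hxq
    have hx1 := hxq.trans_lt hq1
    have hup := (hbd x hx0 hxq).2
    have hlow := (hbd (x ^ (m + 1)) (by positivity)
      ((pow_le_of_le_one hx0.le hx1.le (by positivity)).trans hxq)).1
    rw [← Real.rpow_pow_comm hx0.le] at hlow
    have h0 := thetaRatio_pos hx0 hx1
    calc r x ≤ (C * x ^ (1 / 4 : ℝ)) ^ (m + 1) / (2 ^ m * (c * (x ^ (1 / 4 : ℝ)) ^ (m + 1))) := by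
          simp only [hr]; gcongr
      _ = _ := by rw [mul_pow]; field_simp
  have hone : r q ≤ 1 := le_one_of_forall_pow_two_pow_le fun k => (hiter k).trans
    (hbound _ (by positivity) (pow_le_of_le_one hq0.le hq1.le (by positivity)))
  have := hpos q hq0 hq1
  simpa only [hr, div_le_one (by positivity : 0 < 2 ^ m * thetaRatio (q ^ (m + 1)))] using hone

theorem ellipticModulus_eq_thetaRatio_sq {q : ℝ} (hq0 : 0 < q) (hq1 : q < 1) :
    ellipticModulus q = thetaRatio q ^ 2 := by
  rw [ellipticModulus, if_neg hq0.not_ge, if_neg hq1.not_ge, thetaRatio]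

/-- **Estimate on the elliptic modulus** (Lemma `hasest`).
For `q ∈ [0,1]` and `n ≥ 1` one has `√k(qⁿ) ≥ 2^(1-n) (√k(q))ⁿ`, equivalently
`k(q)ⁿ ≤ 4^(n-1) k(qⁿ)`. -/
theorem sqrt_ellipticModulus_pow_ge (n : ℕ) (hn : 1 ≤ n)
    (q : ℝ) (hq : q ∈ Set.Icc (0 : ℝ) 1) :
    Real.sqrt (ellipticModulus (q ^ n)) ≥
        (2 : ℝ) ^ ((1 : ℝ) - n) * Real.sqrt (ellipticModulus q) ^ n ∧
      ellipticModulus q ^ n ≤ 4 ^ (n - 1) * ellipticModulus (q ^ n) := by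
  have h2 : (2 : ℝ) ^ ((1 : ℝ) - n) = (2 ^ (n - 1))⁻¹ := by
    rw [← Real.rpow_natCast, ← Real.rpow_neg zero_le_two, Nat.cast_sub hn]
    congr 1
    push_cast
    ring
  rw [h2, ge_iff_le, inv_mul_le_iff₀ (by positivity)]
  have hn0 : n ≠ 0 := by omega
  rcases hq.1.eq_or_lt with rfl | hq0
  · simp [ellipticModulus, hn0]
  rcases hq.2.eq_or_lt with rfl | hq1
  · have h : ellipticModulus 1 = 1 := by norm_num [ellipticModulus]
    simp only [one_pow, h, Real.sqrt_one, mul_one]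
    exact ⟨one_le_pow₀ (by norm_num), one_le_pow₀ (by norm_num)⟩
  have hp0 : 0 < q ^ n := by positivity
  have hp1 : q ^ n < 1 := pow_lt_one₀ hq0.le hq1 hn0
  have hmain := thetaRatio_pow_le hn hq0 hq1
  have hpos := thetaRatio_pos hq0 hq1
  rw [ellipticModulus_eq_thetaRatio_sq hq0 hq1, ellipticModulus_eq_thetaRatio_sq hp0 hp1,
    Real.sqrt_sq hpos.le, Real.sqrt_sq (thetaRatio_pos hp0 hp1).le]
  refine ⟨hmain, ?_⟩
  calc (thetaRatio q ^ 2) ^ n = (thetaRatio q ^ n) ^ 2 := pow_right_comm _ _ _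
    _ ≤ (2 ^ (n - 1) * thetaRatio (q ^ n)) ^ 2 := by gcongr
    _ = 4 ^ (n - 1) * thetaRatio (q ^ n) ^ 2 := by
      rw [mul_pow, pow_right_comm]
      norm_num
end
end

section
/- Let n ≥ 1, let c ∈ [0,1], and let s_1, …, s_n be real numbers in (−1, 1). Then max_{s ∈ [0,c]} ∏_{i=1}^{n} |(s − s_i)/(1 − s·s_i)| ≥ cⁿ / 2^(2n − 1). -/
noncomputable section

open Polynomial in
/-- **Chebyshev's inequality on an interval**: a monic real polynomial of positive degree `n`
attains absolute value at least `2 * ((b - a) / 4) ^ n` on `[a, b]`. -/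
theorem exists_le_abs_eval_of_monic {P : ℝ[X]} (hP : P.Monic) (hdeg : P.natDegree ≠ 0)
    {a b : ℝ} (hab : a ≤ b) :
    ∃ x ∈ Set.Icc a b, 2 * ((b - a) / 4) ^ P.natDegree ≤ |P.eval x| := by
  rcases hab.eq_or_lt with rfl | hlt
  · exact ⟨a, by simp, by simp [hdeg]⟩
  obtain ⟨x, hx, hmax⟩ := isCompact_Icc.exists_isMaxOn (Set.nonempty_Icc.2 hab)
    (f := fun x => |P.eval x|) (by fun_prop)
  refine ⟨x, hx, le_of_forall_gt_imp_ge_of_dense fun D hD => ?_⟩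
  have hD0 : 0 < D := (abs_nonneg _).trans_lt hD
  have hr : (b - a) / 2 ≠ 0 := by linarith
  set L : ℝ[X] := C ((b - a) / 2) * X + C ((a + b) / 2) with hL
  have hLdeg : L.natDegree = 1 := natDegree_linear hr
  have hlead : (C D⁻¹ * P.comp L).leadingCoeff = D⁻¹ * ((b - a) / 2) ^ P.natDegree := by
    rw [leadingCoeff_mul, leadingCoeff_C, leadingCoeff_comp (by simp [hLdeg]), hP.leadingCoeff,
      one_mul, hL, leadingCoeff_linear hr]
  have hQdeg : (C D⁻¹ * P.comp L).degree ≤ P.natDegree := by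
    refine degree_le_of_natDegree_le ((natDegree_C_mul_le _ _).trans ?_)
    rw [natDegree_comp, hLdeg, mul_one]
  have hbound := Chebyshev.leadingCoeff_le_of_forall_abs_le_one hQdeg fun y hy => by
    have hmem : (b - a) / 2 * y + (a + b) / 2 ∈ Set.Icc a b := by
      constructor <;> nlinarith [hy.1, hy.2]
    have hle : |P.eval ((b - a) / 2 * y + (a + b) / 2)| ≤ D := (hmax hmem).trans hD.le
    simp only [hL, eval_mul, eval_C, eval_comp, eval_add, eval_X, abs_mul,
      abs_of_pos (inv_pos.2 hD0)]
    rwa [inv_mul_le_iff₀ hD0, mul_one]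
  rw [hlead, inv_mul_le_iff₀ hD0] at hbound
  obtain ⟨m, hm⟩ := Nat.exists_eq_succ_of_ne_zero hdeg
  have hsplit : (b - a) / 2 = 2 * ((b - a) / 4) := by ring
  rw [hm, hsplit, mul_pow, Nat.succ_sub_one, pow_succ 2 m] at hbound
  rw [hm]
  have hpow : (0 : ℝ) < 2 ^ m := by positivity
  nlinarith

/-- On `[0, 1]`, a real Blaschke factor dominates the linear factor whose zero is the positive
part of the zero of the Blaschke factor. -/
theorem abs_sub_max_zero_le_abs_blaschke {s t : ℝ} (hs : s ∈ Set.Ioo (-1 : ℝ) 1)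
    (ht : t ∈ Set.Icc (0 : ℝ) 1) : |t - max s 0| ≤ |(t - s) / (1 - t * s)| := by
  obtain ⟨hs1, hs2⟩ := hs
  obtain ⟨ht0, ht1⟩ := ht
  have hden : 0 < 1 - t * s := by nlinarith
  rw [abs_div, abs_of_pos hden, le_div_iff₀ hden]
  rcases le_total 0 s with h | h
  · rw [max_eq_left h]
    nlinarith [abs_nonneg (t - s), mul_nonneg ht0 h]
  · rw [max_eq_right h, sub_zero, abs_of_nonneg ht0, abs_of_nonneg (by linarith)]
    nlinarith [mul_nonneg (neg_nonneg.2 h) (by nlinarith : 0 ≤ 1 - t ^ 2)]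

/-- **Chebyshev-type lower bound for real Blaschke-type products** (Remark 1 after
Theorem `hyper`). For `c ∈ [0,1]` and `s_1, …, s_n ∈ (-1,1)`,
`max_{s ∈ [0,c]} ∏_{i=1}^n |(s - s_i)/(1 - s s_i)| ≥ cⁿ / 2^(2n-1)`. -/
theorem real_blaschke_chebyshev_lower_bound (n : ℕ) (hn : 1 ≤ n)
    (c : ℝ) (hc : c ∈ Set.Icc (0 : ℝ) 1)
    (s : Fin n → ℝ) (hs : ∀ i, s i ∈ Set.Ioo (-1 : ℝ) 1) :
    ∃ t ∈ Set.Icc (0 : ℝ) c,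
      c ^ n / 2 ^ (2 * n - 1) ≤ ∏ i, |(t - s i) / (1 - t * s i)| := by
  have hmonic := Polynomial.monic_prod_X_sub_C (fun i => max (s i) 0) Finset.univ
  have hdeg : (∏ i, (Polynomial.X - Polynomial.C (max (s i) 0))).natDegree = n := by simp
  obtain ⟨t, ht, hle⟩ := exists_le_abs_eval_of_monic hmonic (by rw [hdeg]; omega) hc.1
  refine ⟨t, ht, ?_⟩
  calc c ^ n / 2 ^ (2 * n - 1) = 2 * ((c - 0) / 4) ^ n := by
        obtain ⟨m, rfl⟩ := Nat.exists_eq_add_of_le' hn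
        rw [show 2 * (m + 1) - 1 = 2 * m + 1 by omega, sub_zero, div_pow, pow_succ 2 (2 * m),
          pow_mul, pow_succ 4 m]
        norm_num
        field_simp
        norm_num
    _ ≤ ∏ i, |t - max (s i) 0| := by
        simpa [hdeg, Polynomial.eval_prod, Finset.abs_prod] using hle
    _ ≤ ∏ i, |(t - s i) / (1 - t * s i)| :=
        Finset.prod_le_prod (fun _ _ => abs_nonneg _) fun i _ =>
          abs_sub_max_zero_le_abs_blaschke (hs i) ⟨ht.1, ht.2.trans hc.2⟩
end
end
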